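/- If X is a topological space with a cover 𝓕 of cardinality at most ω₁ such that every member of 𝓕 is a P-set in X, is nicely placed in X, is C*-embedded in X, and is an F-space in the subspace topology, then X is an F-space. -/

import Mathlib

open Set Cardinal Topology

/-- `U` is a cozero set: the set where some continuous real-valued function is nonzero. -/
def IsCozero {X : Type*} [TopologicalSpace X] (U : Set X) : Prop :=
  ∃ f : C(X, ℝ), U = {x | f x ≠ 0}

/-- `A` is C*-embedded in `X`: every continuous function `A → [0,1]` extends continuously. -/
def IsCStarEmbedded {X : Type*} [TopologicalSpace X] (A : Set X) : Prop :=
  ∀ f : C(A, Set.Icc (0:ℝ) 1), ∃ g : C(X, Set.Icc (0:ℝ) 1), ∀ a : A, g a = f a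

/-- `X` is an F-space: every cozero set is C*-embedded. -/
def IsFSpace (X : Type*) [TopologicalSpace X] : Prop :=
  ∀ U : Set X, IsCozero U → IsCStarEmbedded U

/-- `A` is a P-set: closed, and countable intersections of neighborhoods of `A`
are neighborhoods of `A`. -/
def IsPSet {X : Type*} [TopologicalSpace X] (A : Set X) : Prop :=
  IsClosed A ∧ ∀ N : ℕ → Set X, (∀ n, N n ∈ 𝓝ˢ A) → (⋂ n, N n) ∈ 𝓝ˢ A

/-- `x` is a P-point: countable intersections of neighborhoods of `x` are neighborhoods. -/
def IsPPoint {X : Type*} [TopologicalSpace X] (x : X) : Prop :=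
  ∀ N : ℕ → Set X, (∀ n, N n ∈ 𝓝 x) → (⋂ n, N n) ∈ 𝓝 x

/-- `A` is nicely placed: every open neighborhood of `A` contains a cozero set containing `A`. -/
def IsNicelyPlaced {X : Type*} [TopologicalSpace X] (A : Set X) : Prop :=
  ∀ U : Set X, IsOpen U → A ⊆ U → ∃ V : Set X, IsCozero V ∧ A ⊆ V ∧ V ⊆ U

/-- `F` is an Fσ set: a countable union of closed sets. -/
def IsFSigma {X : Type*} [TopologicalSpace X] (F : Set X) : Prop :=
  ∃ A : ℕ → Set X, (∀ n, IsClosed (A n)) ∧ F = ⋃ n, A n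

section helpers

variable {X : Type*} [TopologicalSpace X]

lemma IsCozero.isOpen' {U : Set X} (h : IsCozero U) : IsOpen U := by
  obtain ⟨f, rfl⟩ := h
  exact isOpen_ne_fun f.continuous continuous_const

lemma IsCozero.union' {U V : Set X} (hU : IsCozero U) (hV : IsCozero V) : IsCozero (U ∪ V) := by
  obtain ⟨f, rfl⟩ := hU
  obtain ⟨g, rfl⟩ := hV
  refine ⟨⟨fun x => |f x| + |g x|, by fun_prop⟩, ?_⟩
  ext x
  simp only [mem_union, mem_ofPred_eq, ContinuousMap.coe_mk]
  have := add_eq_zero_iff_of_nonneg (abs_nonneg (f x)) (abs_nonneg (g x))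
  rw [abs_eq_zero, abs_eq_zero] at this
  tauto

lemma IsCozero.iUnion_nat {U : ℕ → Set X} (hU : ∀ n, IsCozero (U n)) : IsCozero (⋃ n, U n) := by
  choose f hf using hU
  have hnn : ∀ x n, 0 ≤ (1/2 : ℝ)^n * min 1 |f n x| := fun x n => by positivity
  have hle : ∀ x n, (1/2 : ℝ)^n * min 1 |f n x| ≤ (1/2 : ℝ)^n := fun x n =>
    mul_le_of_le_one_right (by positivity) (min_le_left _ _)
  have hs : Summable (fun n : ℕ => (1/2 : ℝ)^n) := summable_geometric_two
  have hsx : ∀ x, Summable (fun n => (1/2 : ℝ)^n * min 1 |f n x|) := fun x =>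
    Summable.of_nonneg_of_le (hnn x) (hle x) hs
  refine ⟨⟨fun x => ∑' n, (1/2 : ℝ)^n * min 1 |f n x|, ?_⟩, ?_⟩
  · refine continuous_tsum (fun n => by fun_prop) hs (fun n x => ?_)
    rw [Real.norm_eq_abs, abs_of_nonneg (hnn x n)]
    exact hle x n
  · ext x
    simp only [mem_iUnion, mem_ofPred_eq, ContinuousMap.coe_mk]
    constructor
    · rintro ⟨n, hn⟩
      rw [hf n] at hn
      have : 0 < |f n x| := abs_pos.mpr hn
      exact ((hsx x).tsum_pos (hnn x) n (by positivity)).ne'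
    · intro h
      by_contra! hc
      apply h
      have : ∀ n, (1/2 : ℝ)^n * min 1 |f n x| = 0 := by
        intro n
        have := hc n
        rw [hf n] at this
        simp only [mem_ofPred_eq, not_not] at this
        simp [this]
      simp only [this, tsum_zero]

/-- Extension order on partial functions. -/
def PExt (p q : Set X × (X → ℝ)) : Prop := p.1 ⊆ q.1 ∧ EqOn p.2 q.2 p.1

/-- Partial functions continuous on a cozero set. -/
def PGood (p : Set X × (X → ℝ)) : Prop :=
  IsCozero p.1 ∧ ContinuousOn p.2 p.1 ∧ ∀ x, p.2 x ∈ Set.Icc (0:ℝ) 1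

lemma PExt.trans' {p q r : Set X × (X → ℝ)} (h : PExt p q) (h' : PExt q r) : PExt p r :=
  ⟨h.1.trans h'.1, fun _ hx => (h.2 hx).trans (h'.2 (h.1 hx))⟩

lemma glue_chain (S : Set (Set X × (X → ℝ))) (hS : ∀ p ∈ S, PGood p)
    (hc : ∀ p ∈ S, ∀ q ∈ S, PExt p q ∨ PExt q p) :
    ∃ h : X → ℝ, ContinuousOn h (⋃ p ∈ S, p.1) ∧ (∀ x, h x ∈ Set.Icc (0:ℝ) 1) ∧
      ∀ p ∈ S, EqOn p.2 h p.1 := by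
  classical
  let h : X → ℝ := fun x => if hx : ∃ p ∈ S, x ∈ p.1 then hx.choose.2 x else 0
  have heq : ∀ p ∈ S, EqOn p.2 h p.1 := by
    intro p hp x hx
    have hex : ∃ p ∈ S, x ∈ p.1 := ⟨p, hp, hx⟩
    have : h x = hex.choose.2 x := dif_pos hex
    rw [this]
    obtain ⟨h1, h2⟩ := hex.choose_spec
    rcases hc _ hp _ h1 with h3 | h3
    · exact h3.2 hx
    · exact (h3.2 h2).symm
  refine ⟨h, ?_, ?_, heq⟩
  · intro x hx
    simp only [mem_iUnion] at hx
    obtain ⟨p, hp, hx⟩ := hx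
    have hn := (hS p hp).1.isOpen'.mem_nhds hx
    have h1 : ContinuousAt p.2 x := (hS p hp).2.1.continuousAt hn
    exact (h1.congr (Filter.eventually_of_mem hn (heq p hp))).continuousWithinAt
  · intro x
    by_cases hx : ∃ p ∈ S, x ∈ p.1
    · obtain ⟨p, hp, hx⟩ := hx
      rw [← heq p hp hx]
      exact (hS p hp).2.2 x
    · have : h x = 0 := dif_neg hx
      rw [this]; simp

lemma step_ext (F : Set X) (hP : IsPSet F) (hnice : IsNicelyPlaced F)
    (hemb : IsCStarEmbedded F) (hF : IsFSpace F) (p : Set X × (X → ℝ)) (hp : PGood p) :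
    ∃ q, PGood q ∧ PExt p q ∧ F ⊆ q.1 := by
  classical
  obtain ⟨Y, h⟩ := p
  obtain ⟨hY, hcont, hI⟩ := hp
  simp only at hY hcont hI
  have hYo := hY.isOpen'
  have hY0 := hY
  obtain ⟨φ, hφ⟩ := hY
  have hco : IsCozero ((Subtype.val : F → X) ⁻¹' Y) := by
    refine ⟨φ.comp ⟨Subtype.val, continuous_subtype_val⟩, ?_⟩
    rw [hφ]; rfl
  let f : C(((Subtype.val : F → X) ⁻¹' Y), Set.Icc (0:ℝ) 1) :=
    ⟨fun y => ⟨h y.1.1, hI _⟩, by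
      refine Continuous.subtype_mk ?_ _
      exact hcont.comp_continuous (continuous_subtype_val.comp continuous_subtype_val)
        (fun y => y.2)⟩
  obtain ⟨g, hg⟩ := hF _ hco f
  obtain ⟨k, hk⟩ := hemb g
  have hkh : ∀ x ∈ F, x ∈ Y → (k x : ℝ) = h x := by
    intro x hx hxY
    rw [hk ⟨x, hx⟩, hg ⟨⟨x, hx⟩, hxY⟩]
    rfl
  have hkc : Continuous (fun x => (k x : ℝ)) := continuous_subtype_val.comp k.continuous
  let ψ : X → ℝ := fun x => φ x * ((k x : ℝ) - h x)
  have hψ : Continuous ψ := by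
    rw [continuous_iff_continuousAt]
    intro x
    by_cases hx : x ∈ Y
    · exact φ.continuous.continuousAt.mul
        (hkc.continuousAt.sub (hcont.continuousAt (hYo.mem_nhds hx)))
    · have h0 : φ x = 0 := by
        rw [hφ] at hx
        simpa using hx
      have : ψ x = 0 := by simp [ψ, h0]
      unfold ContinuousAt
      rw [this]
      refine squeeze_zero_norm (a := fun y => |φ y|) (fun y => ?_) ?_
      · simp only [ψ, Real.norm_eq_abs, abs_mul]
        refine mul_le_of_le_one_right (abs_nonneg _) ?_
        have h1 := (k y).2
        have h2 := hI y
        rw [abs_le]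
        constructor <;> linarith [h1.1, h1.2, h2.1, h2.2]
      · have : ContinuousAt (fun y => |φ y|) x := by fun_prop
        unfold ContinuousAt at this
        simpa [h0] using this
  have hN := hP.2 (fun n => {x | |ψ x| < 1 / ((n:ℝ) + 1)}) (by
    intro n
    refine (isOpen_lt (by fun_prop) continuous_const).mem_nhdsSet.mpr ?_
    intro x hx
    have : ψ x = 0 := by
      by_cases hxY : x ∈ Y
      · simp [ψ, hkh x hx hxY]
      · rw [hφ] at hxY
        simp only [mem_ofPred_eq, not_not] at hxY
        simp [ψ, hxY]
    simp only [mem_ofPred_eq, this, abs_zero]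
    positivity)
  rw [mem_nhdsSet_iff_exists] at hN
  obtain ⟨W, hWo, hFW, hW⟩ := hN
  obtain ⟨V, hV, hFV, hVW⟩ := hnice W hWo hFW
  have hVk : ∀ x ∈ V, x ∈ Y → h x = k x := by
    intro x hx hxY
    have h1 : ψ x = 0 := by
      by_contra hne
      obtain ⟨n, hn⟩ := exists_nat_one_div_lt (abs_pos.mpr hne)
      have := mem_iInter.mp (hW (hVW hx)) n
      simp only [mem_ofPred_eq] at this
      linarith
    rw [hφ] at hxY
    rcases mul_eq_zero.mp h1 with h2 | h2
    · exact absurd h2 hxY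
    · linarith
  let h' : X → ℝ := fun x => if x ∈ Y then h x else k x
  have e1 : EqOn h h' Y := fun x hx => by simp [h', hx]
  have e2 : EqOn (fun x => (k x : ℝ)) h' V := fun x hx => by
    by_cases hxY : x ∈ Y
    · simp [h', hxY, hVk x hx hxY]
    · simp [h', hxY]
  refine ⟨(Y ∪ V, h'), ⟨hY0.union' hV, ?_, ?_⟩, ⟨subset_union_left, e1⟩,
    hFV.trans subset_union_right⟩
  · rintro x (hx | hx)
    · have hn := hYo.mem_nhds hx
      exact ((hcont.continuousAt hn).congr (Filter.eventually_of_mem hn e1)).continuousWithinAt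
    · have hn := hV.isOpen'.mem_nhds hx
      exact (hkc.continuousAt.congr (Filter.eventually_of_mem hn e2)).continuousWithinAt
  · intro x
    by_cases hxY : x ∈ Y
    · simpa [h', hxY] using hI x
    · simpa [h', hxY] using (k x).2

lemma countable_ub (S : Set (Set X × (X → ℝ))) (hS : ∀ p ∈ S, PGood p) (hcount : S.Countable)
    (hne : S.Nonempty) (hc : ∀ p ∈ S, ∀ q ∈ S, PExt p q ∨ PExt q p) :
    ∃ q, PGood q ∧ ∀ p ∈ S, PExt p q := by
  obtain ⟨h, h1, h2, h3⟩ := glue_chain S hS hc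
  refine ⟨(⋃ p ∈ S, p.1, h), ⟨?_, h1, h2⟩, fun p hp => ⟨?_, h3 p hp⟩⟩
  · obtain ⟨e, rfl⟩ := hcount.exists_eq_range hne
    rw [biUnion_range]
    exact IsCozero.iUnion_nat fun n => (hS _ ⟨n, rfl⟩).1
  · exact subset_biUnion_of_mem (u := fun p : Set X × (X → ℝ) => p.1) hp

end helpers

theorem union_of_nicely_placed_CStar_embedded_PSet_FSpaces_is_FSpace
    {X : Type*} [TopologicalSpace X] [T35Space X] (𝓕 : Set (Set X))
    (hcard : #𝓕 ≤ Cardinal.aleph 1) (hcover : ⋃₀ 𝓕 = Set.univ)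
    (hP : ∀ F ∈ 𝓕, IsPSet F) (hnice : ∀ F ∈ 𝓕, IsNicelyPlaced F)
    (hemb : ∀ F ∈ 𝓕, IsCStarEmbedded F) (hF : ∀ F ∈ 𝓕, IsFSpace F) :
    IsFSpace X := by
  classical
  intro U hU u
  let p0 : Set X × (X → ℝ) := (U, fun x => if hx : x ∈ U then (u ⟨x, hx⟩ : ℝ) else 0)
  have hp0 : PGood p0 := by
    refine ⟨hU, ?_, ?_⟩
    · rw [continuousOn_iff_continuous_domRestrict]
      have : U.domRestrict p0.2 = fun x => (u x : ℝ) := by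
        ext x
        show p0.2 x.1 = _
        simp [p0]
      show Continuous (U.domRestrict p0.2)
      rw [this]
      fun_prop
    · intro x
      by_cases hx : x ∈ U
      · simpa [p0, hx] using (u ⟨x, hx⟩).2
      · simp [p0, hx]
  obtain ⟨r, hr, hord⟩ := Cardinal.exists_ord_eq 𝓕
  have hcnt : ∀ i, {j | r j i}.Countable := by
    intro i
    have h1 := Cardinal.card_typein_lt i hord
    have h2 : #{j | r j i} < Cardinal.aleph 1 := lt_of_lt_of_le h1 hcard
    rw [← Cardinal.le_aleph0_iff_set_countable]
    rw [← Order.lt_succ_iff, ← Cardinal.aleph_zero, ← Cardinal.aleph_succ]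
    simpa using h2
  have wf : WellFounded r := hr.wf
  let G : (i : 𝓕) → ((j : 𝓕) → r j i → Set X × (X → ℝ)) → Set X × (X → ℝ) := fun i f =>
    if h : ∃ q, (PGood q ∧ PExt p0 q ∧ i.1 ⊆ q.1) ∧ ∀ j (hj : r j i), PExt (f j hj) q
    then h.choose else p0
  let f : 𝓕 → Set X × (X → ℝ) := wf.fix G
  have key : ∀ i, (PGood (f i) ∧ PExt p0 (f i) ∧ i.1 ⊆ (f i).1) ∧
      ∀ j, r j i → PExt (f j) (f i) := by
    intro i
    induction i using wf.induction with
    | _ i ih =>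
    have hex : ∃ q, (PGood q ∧ PExt p0 q ∧ i.1 ⊆ q.1) ∧ ∀ j (hj : r j i), PExt (f j) q := by
      obtain ⟨q, hq, hub⟩ := countable_ub (insert p0 (f '' {j | r j i}))
        (by
          rintro p (rfl | ⟨j, hj, rfl⟩)
          · exact hp0
          · exact (ih j hj).1.1)
        (((hcnt i).image f).insert _) (insert_nonempty _ _)
        (by
          rintro p (rfl | ⟨j, hj, rfl⟩) q (rfl | ⟨l, hl, rfl⟩)
          · exact Or.inl ⟨subset_rfl, fun _ _ => rfl⟩
          · exact Or.inl (ih l hl).1.2.1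
          · exact Or.inr (ih j hj).1.2.1
          · rcases trichotomous_of r j l with h | h | h
            · exact Or.inl ((ih l hl).2 j h)
            · subst h
              exact Or.inl ⟨subset_rfl, fun _ _ => rfl⟩
            · exact Or.inr ((ih j hj).2 l h))
      obtain ⟨q', h1, h2, h3⟩ := step_ext i.1 (hP _ i.2) (hnice _ i.2) (hemb _ i.2) (hF _ i.2) q hq
      exact ⟨q', ⟨h1, (hub _ (mem_insert _ _)).trans' h2, h3⟩,
        fun j hj => (hub _ (mem_insert_of_mem _ ⟨j, hj, rfl⟩)).trans' h2⟩
    have hfi : f i = hex.choose := by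
      show wf.fix G i = _
      rw [WellFounded.fix_eq]
      exact dif_pos hex
    rw [hfi]
    exact hex.choose_spec
  obtain ⟨h, h1, h2, h3⟩ := glue_chain (range f)
    (by rintro _ ⟨i, rfl⟩; exact (key i).1.1)
    (by
      rintro _ ⟨j, rfl⟩ _ ⟨l, rfl⟩
      rcases trichotomous_of r j l with h | h | h
      · exact Or.inl ((key l).2 j h)
      · subst h
        exact Or.inl ⟨subset_rfl, fun _ _ => rfl⟩
      · exact Or.inr ((key j).2 l h))
  have hall : ∀ x, ∃ i, x ∈ (f i).1 := by
    intro x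
    have hx : x ∈ ⋃₀ 𝓕 := by rw [hcover]; trivial
    obtain ⟨F, hF', hxF⟩ := hx
    exact ⟨⟨F, hF'⟩, (key ⟨F, hF'⟩).1.2.2 hxF⟩
  have huniv : (⋃ p ∈ range f, p.1) = Set.univ := by
    rw [biUnion_range, eq_univ_iff_forall]
    intro x
    exact mem_iUnion.mpr (hall x)
  rw [huniv, continuousOn_univ] at h1
  refine ⟨⟨fun x => ⟨h x, h2 x⟩, h1.subtype_mk _⟩, fun a => ?_⟩
  apply Subtype.ext
  obtain ⟨i, hi⟩ := hall a
  show h a = u a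
  rw [← h3 _ ⟨i, rfl⟩ hi, ← (key i).1.2.1.2 a.2]
  simp [p0]
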